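/- Let n ≥ 10 with n ≡ 4 (mod 6), let k = n − 4, and let ℬ be the binary DFA with 2n−4 states obtained from 𝒜_n by appending a tail of length k at the pre-sink state 1 (with the roles of a and b interchanged in the tail construction, as specified in the context). Then the reset threshold of ℬ equals n² − 13; equivalently, writing N = 2n−4 for the number of states of ℬ, rt(ℬ) = N²/4 + 2N − 9. -/

import Mathlib

/-- The two letters of a binary alphabet. -/
inductive Letter where
  | a : Letter
  | b : Letter
deriving DecidableEq

/-- The transition function of the automaton `𝒜ₙ` on the state set
`Qₙ = {0, 1, …, n-1}` (represented inside `ℕ`):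
`δ(0,a)=δ(0,b)=0`; `δ(1,a)=0`, `δ(2,a)=4`, `δ(3,a)=2`, `δ(4,a)=3`;
`δ(1,b)=3`, `δ(2,b)=1`, `δ(3,b)=2`; and for `4 ≤ j ≤ n-1`:
`δ(j,a) = j-1` if `j ≥ 6` is even, `δ(j,a) = j+1` if `j ≥ 5` is odd and
`j ≠ n-1`, `δ(j,a) = j` if `j = n-1` is odd; `δ(j,b) = j-1` if `j ≥ 5` is odd,
`δ(j,b) = j+1` if `j ≥ 4` is even and `j ≠ n-1`, `δ(j,b) = j` if `j = n-1`
is even. -/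
def anDelta (n : ℕ) (q : ℕ) (ℓ : Letter) : ℕ :=
  match q, ℓ with
  | 0, _ => 0
  | 1, Letter.a => 0
  | 1, Letter.b => 3
  | 2, Letter.a => 4
  | 2, Letter.b => 1
  | 3, _ => 2
  | 4, Letter.a => 3
  | j, Letter.a => if j % 2 = 1 then (if j = n - 1 then j else j + 1) else j - 1
  | j, Letter.b => if j % 2 = 0 then (if j = n - 1 then j else j + 1) else j - 1

/-- Extension of the transition function of `𝒜ₙ` to words:
`δ(q, uv) = δ(δ(q, u), v)`. -/
def anStar (n : ℕ) (q : ℕ) (w : List Letter) : ℕ :=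
  w.foldl (anDelta n) q

/-- The transition function of the automaton `ℬ` obtained from `𝒜ₙ` by
appending a tail of length `k` at the pre-sink state `1`, with the roles of
`a` and `b` interchanged in the tail construction. The tail state `tᵢ`
(for `0 ≤ i ≤ k-1`) is represented by the natural number `n + i`, so the
state set of `ℬ` is `{0, 1, …, n + k - 1}`. Explicitly:
`δ'(s,b) = δ(s,b)` for `s ∈ Qₙ \ {0}`, `δ'(0,b) = t_{k-1}`, `δ'(t₀,b) = t₀`,
`δ'(tᵢ,b) = t_{i-1}` for `1 ≤ i ≤ k-1`; `δ'(s,a) = δ(s,a)` for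
`s ∈ Qₙ \ {0}`, `δ'(t₀,a) = t₀`, and `δ'(s,a) = 1` for
`s ∈ {0, t₁, …, t_{k-1}}`. -/
def bnDelta (n k : ℕ) (q : ℕ) (ℓ : Letter) : ℕ :=
  if q = 0 then (match ℓ with | Letter.a => 1 | Letter.b => n + k - 1)
  else if q < n then anDelta n q ℓ
  else if q = n then n
  else (match ℓ with | Letter.a => 1 | Letter.b => q - 1)

/-- Extension of the transition function of `ℬ` to words. -/
def bnStar (n k : ℕ) (q : ℕ) (w : List Letter) : ℕ :=
  w.foldl (bnDelta n k) q

theorem bnStar_cons (n k q : ℕ) (x : Letter) (w : List Letter) :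
    bnStar n k q (x :: w) = bnStar n k (bnDelta n k q x) w := rfl

theorem bnStar_append (n k q : ℕ) (u w : List Letter) :
    bnStar n k q (u ++ w) = bnStar n k (bnStar n k q u) w := by
  simp [bnStar]

/-! ### Transitions on the states of `𝒜ₙ` other than the sink -/

theorem anDelta_a_cases (n q : ℕ) (hn : n % 2 = 0) (h1 : 1 ≤ q) (h2 : q < n) :
    (q = 1 ∧ anDelta n q .a = 0) ∨ (q = 2 ∧ anDelta n q .a = 4) ∨
    (q = 3 ∧ anDelta n q .a = 2) ∨ (q = 4 ∧ anDelta n q .a = 3) ∨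
    (6 ≤ q ∧ q % 2 = 0 ∧ anDelta n q .a = q - 1) ∨
    (5 ≤ q ∧ q % 2 = 1 ∧ q + 1 < n ∧ anDelta n q .a = q + 1) ∨
    (5 ≤ q ∧ q % 2 = 1 ∧ q + 1 = n ∧ anDelta n q .a = q) := by
  rcases q with _ | _ | _ | _ | _ | q
  all_goals simp [anDelta] at *
  split_ifs <;> omega

theorem anDelta_b_cases (n q : ℕ) (hn : n % 2 = 0) (h1 : 1 ≤ q) (h2 : q < n) :
    (q = 1 ∧ anDelta n q .b = 3) ∨ (q = 2 ∧ anDelta n q .b = 1) ∨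
    (q = 3 ∧ anDelta n q .b = 2) ∨
    (4 ≤ q ∧ q % 2 = 0 ∧ q + 1 < n ∧ anDelta n q .b = q + 1) ∨
    (5 ≤ q ∧ q % 2 = 1 ∧ anDelta n q .b = q - 1) := by
  rcases q with _ | _ | _ | _ | _ | q
  all_goals simp [anDelta] at *
  · omega
  · split_ifs <;> omega

theorem bnDelta_of_pos (n k q : ℕ) (x : Letter) (h1 : 1 ≤ q) (h2 : q < n) :
    bnDelta n k q x = anDelta n q x := by
  simp [bnDelta, h2, Nat.one_le_iff_ne_zero.mp h1]

theorem bnDelta_zero_a (n k : ℕ) : bnDelta n k 0 .a = 1 := rfl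

theorem bnDelta_zero_b (n k : ℕ) : bnDelta n k 0 .b = n + k - 1 := rfl

theorem bnDelta_tail_zero (n k : ℕ) (hn : 0 < n) (x : Letter) : bnDelta n k n x = n := by
  simp [bnDelta, hn.ne']

theorem bnDelta_tail_a (n k q : ℕ) (h : n < q) : bnDelta n k q .a = 1 := by
  rw [bnDelta, if_neg (by omega), if_neg (by omega), if_neg (by omega)]

theorem bnDelta_tail_b (n k q : ℕ) (h : n < q) : bnDelta n k q .b = q - 1 := by
  rw [bnDelta, if_neg (by omega), if_neg (by omega), if_neg (by omega)]

theorem bnStar_sink (n k : ℕ) (hn : 0 < n) (w : List Letter) : bnStar n k n w = n := by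
  induction w with
  | nil => rfl
  | cons x w ih => rw [bnStar_cons, bnDelta_tail_zero n k hn, ih]

theorem anDelta_b_bounds (n q : ℕ) (hn : n % 2 = 0) (h4 : 4 ≤ n) (h1 : 1 ≤ q) (h2 : q < n) :
    1 ≤ anDelta n q .b ∧ anDelta n q .b < n := by
  rcases anDelta_b_cases n q hn h1 h2 with h | h | h | h | h <;> omega

theorem anDelta_b_iterate_six (n q : ℕ) (hn : n % 2 = 0) (h1 : 1 ≤ q) (h2 : q < n)
    : (anDelta n · .b)^[6] q = q := by
  by_cases hq : q ≤ 3
  · interval_cases q <;> rfl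
  · have inv : ∀ q, 4 ≤ q → q < n → anDelta n (anDelta n q .b) .b = q := by
      intro q h3 h2
      rcases anDelta_b_cases n q hn (by omega) h2 with h | h | h | h | h <;>
      rcases anDelta_b_cases n (anDelta n q .b) hn (by omega) (by omega) with
        h' | h' | h' | h' | h' <;> omega
    simp only [Function.iterate_succ, Function.iterate_zero, Function.comp, id,
      inv q (by omega) h2]

theorem bnStar_replicate_b_of_pos (n k j q : ℕ) (hn : n % 2 = 0) (h4 : 4 ≤ n) (h1 : 1 ≤ q)
    (h2 : q < n) : bnStar n k q (List.replicate j .b) = (anDelta n · .b)^[j] q := by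
  induction j generalizing q with
  | zero => rfl
  | succ j ih =>
    rw [List.replicate_succ, bnStar_cons, bnDelta_of_pos n k q _ h1 h2,
      ih _ (anDelta_b_bounds n q hn h4 h1 h2).1 (anDelta_b_bounds n q hn h4 h1 h2).2,
      Function.iterate_succ_apply]

/-- The word `bᵏ` with `6 ∣ k` fixes every state of `Qₙ \ {0}`. -/
theorem bnStar_b_pow_of_pos (n k q : ℕ) (hn : n % 2 = 0) (h4 : 4 ≤ n) (hk : k % 6 = 0)
    (h1 : 1 ≤ q) (h2 : q < n) : bnStar n k q (List.replicate k .b) = q := by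
  rw [bnStar_replicate_b_of_pos n k k q hn h4 h1 h2]
  obtain ⟨j, hj⟩ := Nat.dvd_of_mod_eq_zero hk
  have fix := anDelta_b_iterate_six n q hn h1 h2
  conv_lhs => rw [hj, Function.iterate_mul]
  exact Function.iterate_fixed fix j

theorem bnStar_b_pow_of_tail (n k i j : ℕ) (hn : 0 < n) (hij : i ≤ j) :
    bnStar n k (n + i) (List.replicate j .b) = n := by
  induction j generalizing i with
  | zero => obtain rfl : i = 0 := by omega
            rfl
  | succ j ih =>
    rw [List.replicate_succ, bnStar_cons]
    rcases i with _ | i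
    · rw [Nat.add_zero, bnDelta_tail_zero n k hn, bnStar_sink n k hn]
    · rw [bnDelta_tail_b n k _ (by omega)]
      exact ih i (by omega)

/-- The word `bᵏ` sends `0` and all tail states to `t₀`. -/
theorem bnStar_b_pow_of_zero_or_tail (n k q : ℕ) (hn : 0 < n) (hk : 0 < k)
    (hq : q = 0 ∨ (n ≤ q ∧ q < n + k)) : bnStar n k q (List.replicate k .b) = n := by
  rcases hq with rfl | ⟨h1, h2⟩
  · obtain ⟨j, rfl⟩ : ∃ j, k = j + 1 := ⟨k - 1, by omega⟩
    rw [List.replicate_succ, bnStar_cons, bnDelta_zero_b]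
    exact bnStar_b_pow_of_tail n _ j j hn le_rfl
  · obtain ⟨i, rfl⟩ := Nat.exists_eq_add_of_le h1
    exact bnStar_b_pow_of_tail n k i k hn (by omega)

/-! ### Upper bound -/

/-- Some word of length `l` sends to `t₀` the state `0`, all tail states, and all states of
`Qₙ \ {0}` satisfying `S`. -/
def SinksWithin (n k l : ℕ) (S : ℕ → Prop) : Prop :=
  ∃ w : List Letter, w.length = l ∧
    (∀ q, q = 0 ∨ (n ≤ q ∧ q < n + k) → bnStar n k q w = n) ∧
    ∀ q, 1 ≤ q → q < n → S q → bnStar n k q w = n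

namespace SinksWithin

variable {n k l : ℕ} {S T : ℕ → Prop}

theorem b_pow (hn : 0 < n) (hk : 0 < k) : SinksWithin n k k fun _ => False :=
  ⟨List.replicate k .b, List.length_replicate,
    fun q hq => bnStar_b_pow_of_zero_or_tail n k q hn hk hq, fun _ _ _ h => h.elim⟩

theorem prepend_b (hS : SinksWithin n k l S) (hn : n % 2 = 0) (h4 : 4 ≤ n) (hk : 0 < k)
    (hT : ∀ q, 1 ≤ q → q < n → T q → S (anDelta n q .b)) : SinksWithin n k (l + 1) T := by
  obtain ⟨w, rfl, h0, h1⟩ := hS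
  refine ⟨.b :: w, rfl, fun q hq => ?_, fun q hq1 hq2 hq => ?_⟩
  · rw [bnStar_cons]
    apply h0
    rcases hq with rfl | ⟨hq, hq'⟩
    · rw [bnDelta_zero_b]; omega
    · rcases hq.eq_or_lt with rfl | hq
      · rw [bnDelta_tail_zero n k (by omega)]; omega
      · rw [bnDelta_tail_b n k q hq]; omega
  · obtain ⟨h2, h3⟩ := anDelta_b_bounds n q hn h4 hq1 hq2
    rw [bnStar_cons, bnDelta_of_pos n k q _ hq1 hq2]
    exact h1 _ h2 h3 (hT q hq1 hq2 hq)

theorem anDelta_a_sinks {w : List Letter} (hn : n % 2 = 0) (h6 : 6 ≤ n)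
    (h0 : bnStar n k 0 w = n) (h1 : ∀ q, 1 ≤ q → q < n → S q → bnStar n k q w = n)
    (hT : ∀ q, 1 ≤ q → q < n → T q → q = 1 ∨ S (anDelta n q .a))
    (q : ℕ) (hq1 : 1 ≤ q) (hq2 : q < n) (hq : T q) : bnStar n k q (.a :: w) = n := by
  rw [bnStar_cons, bnDelta_of_pos n k q _ hq1 hq2]
  rcases hT q hq1 hq2 hq with rfl | h
  · exact h0
  · rcases (anDelta n q .a).eq_zero_or_pos with h' | h'
    · rw [h', h0]
    · refine h1 _ h' ?_ h
      rcases anDelta_a_cases n q hn hq1 hq2 with h | h | h | h | h | h | h <;> omega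

theorem prepend_a (hS : SinksWithin n k l S) (hn : n % 2 = 0) (h6 : 6 ≤ n) (hS1 : S 1)
    (hT : ∀ q, 1 ≤ q → q < n → T q → q = 1 ∨ S (anDelta n q .a)) :
    SinksWithin n k (l + 1) T := by
  obtain ⟨w, rfl, h0, h1⟩ := hS
  refine ⟨.a :: w, rfl, fun q hq => ?_, anDelta_a_sinks hn h6 (h0 0 (.inl rfl)) h1 hT⟩
  rw [bnStar_cons]
  rcases hq with rfl | ⟨hq, hq'⟩
  · exact h1 1 le_rfl (by omega) hS1
  · rcases hq.eq_or_lt with rfl | hq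
    · rw [bnDelta_tail_zero n k (by omega), bnStar_sink n k (by omega)]
    · rw [bnDelta_tail_a n k q hq]
      exact h1 1 le_rfl (by omega) hS1

theorem prepend_b_pow_a (hS : SinksWithin n k l S) (hn : n % 2 = 0) (h6 : 6 ≤ n) (hk : 0 < k)
    (hk6 : k % 6 = 0) (hT : ∀ q, 1 ≤ q → q < n → T q → q = 1 ∨ S (anDelta n q .a)) :
    SinksWithin n k (l + k + 1) T := by
  obtain ⟨w, rfl, h0, h1⟩ := hS
  refine ⟨List.replicate k .b ++ .a :: w, by simp; omega, fun q hq => ?_,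
    fun q hq1 hq2 hq => ?_⟩
  · rw [bnStar_append, bnStar_b_pow_of_zero_or_tail n k q (by omega) hk hq,
      bnStar_sink n k (by omega)]
  · rw [bnStar_append, bnStar_b_pow_of_pos n k q hn (by omega) hk6 hq1 hq2]
    exact anDelta_a_sinks hn h6 (h0 0 (.inl rfl)) h1 hT q hq1 hq2 hq

end SinksWithin

/-- The states of `Qₙ \ {0}` sent to `t₀` after `c / 4` rounds of the periodic part of the
shortest reset word. -/
def periodicSunk (n c q : ℕ) : Prop :=
  q = 3 ∨ q = 4 ∨ (q % 2 = 1 ∧ 5 ≤ q ∧ q ≤ 5 + c) ∨ (q % 2 = 0 ∧ 6 ≤ q ∧ 2 * n ≤ q + 6 + c)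

theorem sinksWithin_periodicSunk_zero (n k : ℕ) (hn : n % 2 = 0) (h10 : 10 ≤ n) (hk : 0 < k)
    (hk6 : k % 6 = 0) : SinksWithin n k (4 * k + 9) (periodicSunk n 0) := by
  have A := fun q h1 h2 => anDelta_a_cases n q hn h1 h2
  have B := fun q h1 h2 => anDelta_b_cases n q hn h1 h2
  have h6 : 6 ≤ n := by omega
  have h4 : 4 ≤ n := by omega
  have s0 := SinksWithin.b_pow (n := n) (by omega) hk
  have s1 := s0.prepend_b_pow_a (T := fun q => q = 1) hn h6 hk hk6
    (by intro q h1 h2 h; have := A q h1 h2; omega)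
  have s2 := s1.prepend_b (T := fun q => q = 2) hn h4 hk
    (by intro q h1 h2 h; have := B q h1 h2; omega)
  have s3 := s2.prepend_b_pow_a (T := fun q => q = 1 ∨ q = 3) hn h6 hk hk6
    (by intro q h1 h2 h; have := A q h1 h2; omega)
  have s4 := s3.prepend_a (T := fun q => q = 1 ∨ q = 4) hn h6 (by omega)
    (by intro q h1 h2 h; have := A q h1 h2; omega)
  have s5 := s4.prepend_b (T := fun q => q = 2 ∨ q = 5) hn h4 hk
    (by intro q h1 h2 h; have := B q h1 h2; omega)
  have s6 := s5.prepend_b_pow_a (T := fun q => q = 1 ∨ q = 3 ∨ q = 6) hn h6 hk hk6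
    (by intro q h1 h2 h; have := A q h1 h2; omega)
  have s7 := s6.prepend_a (T := fun q => q = 1 ∨ q = 4 ∨ q = 5) hn h6 (by omega)
    (by intro q h1 h2 h; have := A q h1 h2; omega)
  have s8 := s7.prepend_b (T := fun q => q = 2 ∨ q = 4 ∨ q = 5) hn h4 hk
    (by intro q h1 h2 h; have := B q h1 h2; omega)
  have s9 := s8.prepend_b (T := periodicSunk n 0) hn h4 hk
    (by intro q h1 h2 h; have := B q h1 h2; simp only [periodicSunk] at *; omega)
  convert s9 using 1
  omega

theorem SinksWithin.periodicSunk_step {n k l c : ℕ} (hs : SinksWithin n k l (periodicSunk n c))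
    (hn : n % 2 = 0) (h10 : 10 ≤ n) (hk : 0 < k) (hk6 : k % 6 = 0) (hc : c % 2 = 0)
    (hcn : c + 24 ≤ 2 * n) :
    SinksWithin n k (l + 2 * k + 8) (periodicSunk n (c + 4)) := by
  have A := fun q h1 h2 => anDelta_a_cases n q hn h1 h2
  have B := fun q h1 h2 => anDelta_b_cases n q hn h1 h2
  have h6 : 6 ≤ n := by omega
  have h4 : 4 ≤ n := by omega
  have s1 := hs.prepend_b_pow_a (T := fun q => q = 1 ∨ q = 2 ∨ q = 4 ∨
    (q % 2 = 0 ∧ 6 ≤ q ∧ q ≤ 6 + c) ∨ (q % 2 = 1 ∧ 2 * n ≤ q + 7 + c)) hn h6 hk hk6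
    (by intro q h1 h2 h; have := A q h1 h2; simp only [periodicSunk] at *; omega)
  have s2 := s1.prepend_b (T := fun q => q = 2 ∨ q = 3 ∨
    (q % 2 = 1 ∧ 5 ≤ q ∧ q ≤ 7 + c) ∨ (q % 2 = 0 ∧ 2 * n ≤ q + 8 + c)) hn h4 hk
    (by intro q h1 h2 h; have := B q h1 h2; omega)
  have s3 := s2.prepend_b_pow_a (T := fun q => q = 1 ∨ q = 3 ∨ q = 4 ∨
    (q % 2 = 0 ∧ 6 ≤ q ∧ q ≤ 8 + c) ∨ (q % 2 = 1 ∧ 2 * n ≤ q + 9 + c)) hn h6 hk hk6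
    (by intro q h1 h2 h; have := A q h1 h2; omega)
  have s4 := s3.prepend_b (T := fun q => q = 1 ∨ q = 2 ∨
    (q % 2 = 1 ∧ 5 ≤ q ∧ q ≤ 9 + c) ∨ (q % 2 = 0 ∧ 2 * n ≤ q + 10 + c)) hn h4 hk
    (by intro q h1 h2 h; have := B q h1 h2; omega)
  have s5 := s4.prepend_a (T := fun q => q = 1 ∨ q = 3 ∨
    (q % 2 = 0 ∧ 6 ≤ q ∧ q ≤ 10 + c) ∨ (q % 2 = 1 ∧ 2 * n ≤ q + 11 + c)) hn h6 (by omega)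
    (by intro q h1 h2 h; have := A q h1 h2; omega)
  have s6 := s5.prepend_a (T := fun q => q = 1 ∨ q = 4 ∨
    (q % 2 = 1 ∧ 5 ≤ q ∧ q ≤ 9 + c) ∨ (q % 2 = 0 ∧ 2 * n ≤ q + 10 + c)) hn h6 (by omega)
    (by intro q h1 h2 h; have := A q h1 h2; omega)
  have s7 := s6.prepend_b (T := fun q => q = 2 ∨ q = 4 ∨ q = 5 ∨
    (q % 2 = 0 ∧ 6 ≤ q ∧ q ≤ 8 + c) ∨ (q % 2 = 1 ∧ 2 * n ≤ q + 9 + c)) hn h4 hk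
    (by intro q h1 h2 h; have := B q h1 h2; omega)
  have s8 := s7.prepend_b (T := periodicSunk n (c + 4)) hn h4 hk
    (by intro q h1 h2 h; have := B q h1 h2; simp only [periodicSunk] at *; omega)
  convert s8 using 1
  omega

theorem SinksWithin.of_periodicSunk {n k l : ℕ}
    (hs : SinksWithin n k l (periodicSunk n (2 * n - 20)))
    (hn : n % 2 = 0) (h10 : 10 ≤ n) (hk : 0 < k)
    (hk6 : k % 6 = 0) : SinksWithin n k (l + 6 * k + 18) fun _ => True := by
  have A := fun q h1 h2 => anDelta_a_cases n q hn h1 h2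
  have B := fun q h1 h2 => anDelta_b_cases n q hn h1 h2
  have h6 : 6 ≤ n := by omega
  have h4 : 4 ≤ n := by omega
  have s1 := hs.prepend_b_pow_a (T := fun q => q ≠ 3 ∧ q ≠ 5 ∧ q ≠ 7 ∧ q ≠ 9 ∧ q ≠ 11 ∧
    (n = 10 → q ≠ 8)) hn h6 hk hk6
    (by intro q h1 h2 h; have := A q h1 h2; simp only [periodicSunk] at *; omega)
  have s2 := s1.prepend_b (T := fun q => q ≠ 1 ∧ q ≠ 4 ∧ q ≠ 6 ∧ q ≠ 8 ∧ q ≠ 10 ∧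
    (n = 10 → q ≠ 9)) hn h4 hk
    (by intro q h1 h2 h; have := B q h1 h2; omega)
  have s3 := s2.prepend_b_pow_a (T := fun q => q ≠ 2 ∧ q ≠ 5 ∧ q ≠ 7 ∧ q ≠ 9) hn h6 hk hk6
    (by intro q h1 h2 h; have := A q h1 h2; omega)
  have s4 := s3.prepend_b (T := fun q => q ≠ 3 ∧ q ≠ 4 ∧ q ≠ 6 ∧ q ≠ 8) hn h4 hk
    (by intro q h1 h2 h; have := B q h1 h2; omega)
  have s5 := s4.prepend_b (T := fun q => q ≠ 1 ∧ q ≠ 5 ∧ q ≠ 7 ∧ q ≠ 9) hn h4 hk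
    (by intro q h1 h2 h; have := B q h1 h2; omega)
  have s6 := s5.prepend_b (T := fun q => q ≠ 2 ∧ q ≠ 4 ∧ q ≠ 6 ∧ q ≠ 8) hn h4 hk
    (by intro q h1 h2 h; have := B q h1 h2; omega)
  have s7 := s6.prepend_a (T := fun q => q ≠ 2 ∧ q ≠ 3 ∧ q ≠ 5 ∧ q ≠ 7) hn h6 (by omega)
    (by intro q h1 h2 h; have := A q h1 h2; omega)
  have s8 := s7.prepend_b (T := fun q => q ≠ 1 ∧ q ≠ 3 ∧ q ≠ 4 ∧ q ≠ 6) hn h4 hk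
    (by intro q h1 h2 h; have := B q h1 h2; omega)
  have s9 := s8.prepend_b_pow_a (T := fun q => q ≠ 2 ∧ q ≠ 4 ∧ q ≠ 5) hn h6 hk hk6
    (by intro q h1 h2 h; have := A q h1 h2; omega)
  have s10 := s9.prepend_a (T := fun q => q ≠ 2 ∧ q ≠ 3 ∧ q ≠ 6) hn h6 (by omega)
    (by intro q h1 h2 h; have := A q h1 h2; omega)
  have s11 := s10.prepend_b (T := fun q => q ≠ 1 ∧ q ≠ 3 ∧ q ≠ 7) hn h4 hk
    (by intro q h1 h2 h; have := B q h1 h2; omega)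
  have s12 := s11.prepend_b (T := fun q => q ≠ 1 ∧ q ≠ 2 ∧ q ≠ 6) hn h4 hk
    (by intro q h1 h2 h; have := B q h1 h2; omega)
  have s13 := s12.prepend_b_pow_a (T := fun q => q ≠ 3 ∧ q ≠ 5) hn h6 hk hk6
    (by intro q h1 h2 h; have := A q h1 h2; omega)
  have s14 := s13.prepend_b (T := fun q => q ≠ 1 ∧ q ≠ 4) hn h4 hk
    (by intro q h1 h2 h; have := B q h1 h2; omega)
  have s15 := s14.prepend_b_pow_a (T := fun q => q ≠ 2) hn h6 hk hk6
    (by intro q h1 h2 h; have := A q h1 h2; omega)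
  have s16 := s15.prepend_a (T := fun q => q ≠ 3) hn h6 (by omega)
    (by intro q h1 h2 h; have := A q h1 h2; omega)
  have s17 := s16.prepend_b (T := fun q => q ≠ 1) hn h4 hk
    (by intro q h1 h2 h; have := B q h1 h2; omega)
  have s18 := s17.prepend_b_pow_a (T := fun _ => True) hn h6 hk hk6
    (by intro q h1 h2 h; have := A q h1 h2; omega)
  convert s18 using 1
  omega

theorem sinksWithin_true (n : ℕ) (hn : 10 ≤ n) (hmod : n % 6 = 4) :
    SinksWithin n (n - 4) (n ^ 2 - 13) fun _ => True := by
  have hs : ∀ i, 2 * i + 10 ≤ n →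
      SinksWithin n (n - 4) (4 * (n - 4) + 9 + i * (2 * (n - 4) + 8)) (periodicSunk n (4 * i)) := by
    intro i
    induction i with
    | zero =>
      intro _
      simpa using sinksWithin_periodicSunk_zero n (n - 4) (by omega) hn (by omega) (by omega)
    | succ i ih =>
      intro hi
      convert (ih (by omega)).periodicSunk_step (by omega) hn (by omega) (by omega) (by omega)
        (by omega) using 1
      · ring
      · rw [Nat.mul_add_one]
  obtain ⟨i, rfl⟩ : ∃ i, n = 2 * i + 10 := ⟨(n - 10) / 2, by omega⟩
  have h := hs i le_rfl
  rw [show 4 * i = 2 * (2 * i + 10) - 20 by omega] at h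
  convert h.of_periodicSunk (by omega) hn (by omega) (by omega) using 1
  rw [show 2 * i + 10 - 4 = 2 * i + 6 by omega]
  exact Nat.sub_eq_of_eq_add (by ring)

/-! ### Lower bound -/

/-- A potential of a set of states sent to `t₀`, depending only on which of the states
`0, …, 6` it misses: a letter prepended to a word
raises it by at most one, unless it sinks `0`, and sinking `0` lowers it by at least four. -/
def potential (u₀ u₁ u₂ u₃ u₄ u₅ u₆ : Bool) : ℕ :=
  [0, 4, 3, 7, 1, 5, 5, 9, 2, 6, 5, 9, 4, 8, 8, 12,
   1, 5, 4, 8, 3, 7, 7, 11, 2, 6, 6, 10, 6, 10, 10, 14,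
   0, 4, 3, 7, 1, 5, 5, 9, 3, 7, 7, 11, 5, 9, 9, 13,
   2, 6, 5, 9, 3, 7, 7, 11, 4, 8, 7, 11, 7, 11, 10, 14,
   0, 4, 3, 7, 2, 6, 6, 10, 2, 6, 5, 9, 4, 8, 8, 12,
   1, 5, 4, 8, 4, 8, 8, 12, 2, 6, 6, 10, 6, 10, 10, 14,
   0, 4, 3, 7, 2, 6, 6, 10, 3, 7, 7, 11, 5, 9, 9, 13,
   3, 7, 5, 9, 4, 8, 8, 12, 4, 8, 7, 11, 6, 10, 9, 13].getD
    (u₀.toNat + 2 * u₁.toNat + 4 * u₂.toNat + 8 * u₃.toNat + 16 * u₄.toNat + 32 * u₅.toNat +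
      64 * u₆.toNat) 0

theorem potential_a : ∀ u₀ u₁ u₂ u₃ u₄ u₅ u₆ : Bool,
    potential u₁ u₀ u₄ u₂ u₃ u₆ u₅ ≤ potential u₀ u₁ u₂ u₃ u₄ u₅ u₆ + 1 := by
  decide +kernel

theorem potential_b : ∀ u₀ u₁ u₂ u₃ u₄ u₅ u₆ u₇ : Bool,
    potential u₀ u₃ u₁ u₂ u₅ u₄ u₇ ≤ potential u₀ u₁ u₂ u₃ u₄ u₅ u₆ + 1 := by
  decide +kernel

theorem potential_sink_zero : ∀ u₁ u₂ u₃ u₄ u₅ u₆ : Bool,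
    potential false u₁ u₂ u₃ u₄ u₅ u₆ + 4 ≤ potential true u₁ u₂ u₃ u₄ u₅ u₆ := by
  decide +kernel

/-- The states of `Qₙ` that `w` sends to `t₀`. -/
def sunk (n k : ℕ) (w : List Letter) : Finset ℕ :=
  {q ∈ Finset.range n | bnStar n k q w = n}

/-- Whether `w` does not send `q` to `t₀`. -/
def unsunk (n k : ℕ) (w : List Letter) (q : ℕ) : Bool :=
  bnStar n k q w ≠ n

/-- The potential of the set of states that `w` sends to `t₀`. -/
def wordPotential (n k : ℕ) (w : List Letter) : ℕ :=
  potential (unsunk n k w 0) (unsunk n k w 1) (unsunk n k w 2) (unsunk n k w 3)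
    (unsunk n k w 4) (unsunk n k w 5) (unsunk n k w 6)

theorem unsunk_cons (n k : ℕ) (x : Letter) (w : List Letter) (q : ℕ) :
    unsunk n k (x :: w) q = unsunk n k w (bnDelta n k q x) := rfl

/-- Unless `w` starts with `bⁱ`, it sends `tᵢ` to `t₀` exactly when it sends `0` there. -/
theorem bnStar_tail_eq_iff_zero (n k : ℕ) (hn : 0 < n) (hk : 2 ≤ k) (w : List Letter) (i : ℕ)
    (hi : 1 ≤ i) (hik : i < k) (hw : ¬ List.replicate i .b <+: w) :
    bnStar n k (n + i) w = n ↔ bnStar n k 0 w = n := by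
  induction w generalizing i with
  | nil => simp [bnStar]; omega
  | cons x w ih =>
    rw [bnStar_cons, bnStar_cons]
    cases x with
    | a => rw [bnDelta_tail_a n k _ (by omega), bnDelta_zero_a]
    | b =>
      obtain ⟨i, rfl⟩ : ∃ j, i = j + 1 := ⟨i - 1, by omega⟩
      rw [List.replicate_succ, List.cons_prefix_cons] at hw
      replace hw : ¬ List.replicate i .b <+: w := fun h => hw ⟨rfl, h⟩
      have hi : 1 ≤ i := by
        by_contra h0
        obtain rfl : i = 0 := by omega
        exact hw (List.nil_prefix)
      rw [bnDelta_tail_b n k _ (by omega), bnDelta_zero_b, ← Nat.add_assoc, Nat.add_sub_cancel,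
        Nat.add_sub_assoc (by omega)]
      rw [ih i hi (by omega) hw, ih (k - 1) (by omega) (by omega)]
      refine fun h => hw (List.IsPrefix.trans ?_ h)
      exact ⟨List.replicate (k - 1 - i) .b, by
        rw [← List.replicate_add]; congr 1; omega⟩

theorem card_sunk_cons_a (n k : ℕ) (hn : n % 2 = 0) (h6 : 6 ≤ n) (w : List Letter) :
    (sunk n k (.a :: w)).card ≤ (sunk n k w).card := by
  have key : ∀ q, q < n → (q = 0 ∧ bnDelta n k q .a = 1) ∨
      (1 ≤ q ∧ bnDelta n k q .a = anDelta n q .a) := fun q hq => by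
    rcases q.eq_zero_or_pos with rfl | h
    · exact .inl ⟨rfl, rfl⟩
    · exact .inr ⟨h, bnDelta_of_pos n k q _ h hq⟩
  refine Finset.card_le_card_of_injOn (bnDelta n k · .a) (fun q hq => ?_)
    (fun p hp q hq hpq => ?_)
  · simp only [sunk, Finset.coe_filter, Finset.mem_range, Set.mem_ofPred_eq] at hq ⊢
    refine ⟨?_, hq.2⟩
    rcases key q hq.1 with h | h
    · omega
    · have := anDelta_a_cases n q hn h.1 hq.1
      omega
  · simp only [sunk, Finset.coe_filter, Finset.mem_range, Set.mem_ofPred_eq] at hp hq hpq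
    rcases key q hq.1 with h | h <;> rcases key p hp.1 with h' | h'
    · omega
    · have := anDelta_a_cases n p hn h'.1 hp.1
      omega
    · have := anDelta_a_cases n q hn h.1 hq.1
      omega
    · have := anDelta_a_cases n p hn h'.1 hp.1
      have := anDelta_a_cases n q hn h.1 hq.1
      omega

theorem card_sunk_cons_b (n k : ℕ) (hn : n % 2 = 0) (h6 : 6 ≤ n) (w : List Letter)
    (h0 : bnStar n k 0 (.b :: w) = n ↔ bnStar n k 0 w = n) :
    (sunk n k (.b :: w)).card ≤ (sunk n k w).card := by
  have zero : anDelta n 0 .b = 0 := rfl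
  refine Finset.card_le_card_of_injOn (anDelta n · .b) (fun q hq => ?_)
    (fun p hp q hq hpq => ?_)
  · simp only [sunk, Finset.coe_filter, Finset.mem_range, Set.mem_ofPred_eq] at hq ⊢
    rcases q.eq_zero_or_pos with rfl | h
    · exact ⟨by omega, h0.1 hq.2⟩
    · refine ⟨(anDelta_b_bounds n q hn (by omega) h hq.1).2, ?_⟩
      rw [← bnDelta_of_pos n k q _ h hq.1]
      exact hq.2
  · simp only [sunk, Finset.coe_filter, Finset.mem_range, Set.mem_ofPred_eq] at hp hq hpq
    rcases q.eq_zero_or_pos with rfl | h <;> rcases p.eq_zero_or_pos with rfl | h'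
    · rfl
    · have := anDelta_b_bounds n p hn (by omega) h' hp.1
      omega
    · have := anDelta_b_bounds n q hn (by omega) h hq.1
      omega
    · have := anDelta_b_cases n p hn h' hp.1
      have := anDelta_b_cases n q hn h hq.1
      omega

theorem wordPotential_cons_a (n k : ℕ) (hn : 7 ≤ n) (w : List Letter) (hn2 : n % 2 = 0) :
    wordPotential n k (.a :: w) ≤ wordPotential n k w + 1 := by
  have e : ∀ q, 1 ≤ q → q < n → unsunk n k (.a :: w) q = unsunk n k w (anDelta n q .a) :=
    fun q h1 h2 => by rw [unsunk_cons, bnDelta_of_pos n k q _ h1 h2]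
  have h5 : anDelta n 5 .a = 6 := by
    have := anDelta_a_cases n 5 hn2 (by omega) (by omega)
    omega
  rw [wordPotential, unsunk_cons n k _ _ 0, e 1, e 2, e 3, e 4, e 5, e 6, h5]
  · exact potential_a ..
  all_goals omega

theorem wordPotential_cons_b (n k : ℕ) (hn : 8 ≤ n) (w : List Letter) (hn2 : n % 2 = 0)
    (h0 : bnStar n k 0 (.b :: w) = n ↔ bnStar n k 0 w = n) :
    wordPotential n k (.b :: w) ≤ wordPotential n k w + 1 := by
  have e : ∀ q, 1 ≤ q → q < n → unsunk n k (.b :: w) q = unsunk n k w (anDelta n q .b) :=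
    fun q h1 h2 => by rw [unsunk_cons, bnDelta_of_pos n k q _ h1 h2]
  have e0 : unsunk n k (.b :: w) 0 = unsunk n k w 0 := by simp only [unsunk, ne_eq, h0]
  have h4 : anDelta n 4 .b = 5 := by
    have := anDelta_b_cases n 4 hn2 (by omega) (by omega)
    omega
  rw [wordPotential, e0, e 1, e 2, e 3, e 4, e 5, e 6, h4]
  · exact potential_b ..
  all_goals omega

/-- Prepending `bᵏ` sends `0` to `t₀` and changes nothing else in `Qₙ`. -/
theorem mul_card_sunk_b_pow_append (n k : ℕ) (hn : n = k + 4) (hk : 6 ≤ k) (hk6 : k % 6 = 0)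
    (w : List Letter) :
    n * (sunk n k (List.replicate k .b ++ w)).card
        + wordPotential n k (List.replicate k .b ++ w) ≤
      n * (sunk n k w).card + wordPotential n k w + k := by
  set v := List.replicate k .b ++ w with hv
  have zero : bnStar n k 0 v = n := by
    rw [hv, bnStar_append, bnStar_b_pow_of_zero_or_tail n k 0 (by omega) (by omega) (.inl rfl),
      bnStar_sink n k (by omega)]
  have pos : ∀ q, 1 ≤ q → q < n → bnStar n k q v = bnStar n k q w := fun q h1 h2 => by
    rw [hv, bnStar_append, bnStar_b_pow_of_pos n k q (by omega) (by omega) hk6 h1 h2]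
  have e : ∀ q, 1 ≤ q → q < n → unsunk n k v q = unsunk n k w q := fun q h1 h2 => by
    simp only [unsunk, pos q h1 h2]
  have e0 : unsunk n k v 0 = false := by simp [unsunk, zero]
  have hpot : wordPotential n k v = potential false (unsunk n k w 1) (unsunk n k w 2)
      (unsunk n k w 3) (unsunk n k w 4) (unsunk n k w 5) (unsunk n k w 6) := by
    rw [wordPotential, e0, e 1, e 2, e 3, e 4, e 5, e 6]
    all_goals omega
  have hsub : sunk n k v ⊆ insert 0 (sunk n k w) := by
    intro q hq
    simp only [sunk, Finset.mem_filter, Finset.mem_range, Finset.mem_insert] at hq ⊢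
    rcases q.eq_zero_or_pos with h | h
    · exact .inl h
    · exact .inr ⟨hq.1, by rw [← pos q h hq.1, hq.2]⟩
  have hcard := Finset.card_le_card hsub
  by_cases h0 : bnStar n k 0 w = n
  · have hmem : 0 ∈ sunk n k w := by
      simp only [sunk, Finset.mem_filter, Finset.mem_range]
      exact ⟨by omega, h0⟩
    rw [Finset.insert_eq_of_mem hmem] at hcard
    have e0' : unsunk n k w 0 = false := by simp [unsunk, h0]
    rw [hpot, wordPotential, e0']
    have := Nat.mul_le_mul_left n hcard
    omega
  · have e0' : unsunk n k w 0 = true := by simp [unsunk, h0]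
    have h4 := potential_sink_zero (unsunk n k w 1) (unsunk n k w 2)
      (unsunk n k w 3) (unsunk n k w 4) (unsunk n k w 5) (unsunk n k w 6)
    rw [hpot, wordPotential, e0']
    have := Nat.mul_le_mul_left n (hcard.trans (Finset.card_insert_le _ _))
    rw [Nat.mul_add] at this
    omega

theorem mul_card_sunk_le (n k : ℕ) (hn : n = k + 4) (hk : 6 ≤ k) (hk6 : k % 6 = 0) :
    ∀ w : List Letter, n * (sunk n k w).card + wordPotential n k w ≤ w.length + 13 := by
  intro w
  induction hl : w.length using Nat.strong_induction_on generalizing w with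
  | _ l ih =>
    subst hl
    by_cases hp : List.replicate k Letter.b <+: w
    · obtain ⟨v, rfl⟩ := hp
      have h1 := mul_card_sunk_b_pow_append n k hn hk hk6 v
      have hlen : (List.replicate k Letter.b ++ v).length = k + v.length := by simp
      have h2 := ih v.length (by omega) v rfl
      omega
    · rcases w with _ | ⟨x, w⟩
      · have h1 : sunk n k [] = ∅ := by
          refine Finset.filter_eq_empty_iff.2 fun q hq => ?_
          exact (Finset.mem_range.1 hq).ne
        have h2 : ∀ q, q < n → unsunk n k [] q = true := fun q hq => by
          simp [unsunk, bnStar, hq.ne]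
        rw [h1, wordPotential, h2 0, h2 1, h2 2, h2 3, h2 4, h2 5, h2 6]
        · simp [potential]
        all_goals omega
      · have h1 := ih w.length (by simp) w rfl
        rw [List.length_cons]
        cases x with
        | a =>
          have h2 := wordPotential_cons_a n k (by omega) w (by omega)
          have h3 := Nat.mul_le_mul_left n (card_sunk_cons_a n k (by omega) (by omega) w)
          omega
        | b =>
          have h0 : bnStar n k 0 (.b :: w) = n ↔ bnStar n k 0 w = n := by
            rw [bnStar_cons, bnDelta_zero_b, Nat.add_sub_assoc (by omega)]
            refine bnStar_tail_eq_iff_zero n k (by omega) (by omega) w _ (by omega) (by omega)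
              fun h => hp ?_
            obtain ⟨j, rfl⟩ : ∃ j, k = j + 1 := ⟨k - 1, by omega⟩
            rw [List.replicate_succ, List.cons_prefix_cons]
            exact ⟨rfl, h⟩
          have h2 := wordPotential_cons_b n k (by omega) w (by omega) h0
          have h3 := Nat.mul_le_mul_left n (card_sunk_cons_b n k (by omega) (by omega) w h0)
          omega

/-- For `n ≥ 10` with `n ≡ 4 (mod 6)` and `k = n - 4`, the automaton `ℬ`
with `2n - 4` states obtained from `𝒜ₙ` by appending a tail of length `k`
at the pre-sink state `1` has reset threshold exactly `n² - 13`;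
equivalently, with `N = 2n - 4` states, its reset threshold is
`N²/4 + 2N - 9`. -/
theorem bn_resetThreshold (n : ℕ) (hn : 10 ≤ n) (hmod : n % 6 = 4) :
    sInf {l : ℕ | ∃ w : List Letter,
        (∀ p q : ℕ, p < 2 * n - 4 → q < 2 * n - 4 →
          bnStar n (n - 4) p w = bnStar n (n - 4) q w) ∧ w.length = l}
      = n ^ 2 - 13 ∧
    n ^ 2 - 13 = (2 * n - 4) ^ 2 / 4 + 2 * (2 * n - 4) - 9 := by
  refine ⟨IsLeast.csInf_eq ⟨?_, ?_⟩, ?_⟩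
  · obtain ⟨w, hw, h0, h1⟩ := sinksWithin_true n hn hmod
    have all : ∀ q, q < 2 * n - 4 → bnStar n (n - 4) q w = n := fun q hq => by
      by_cases h : 1 ≤ q ∧ q < n
      · exact h1 q h.1 h.2 trivial
      · exact h0 q (by omega)
    exact ⟨w, fun p q hp hq => by rw [all p hp, all q hq], hw⟩
  · rintro l ⟨w, hw, rfl⟩
    have hsunk : sunk n (n - 4) w = Finset.range n := by
      refine Finset.filter_true_of_mem fun q hq => ?_
      rw [Finset.mem_range] at hq
      rw [hw q n (by omega) (by omega), bnStar_sink n _ (by omega)]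
    have h := mul_card_sunk_le n (n - 4) (by omega) (by omega) (by omega) w
    rw [hsunk, Finset.card_range, ← pow_two] at h
    omega
  · obtain ⟨m, rfl⟩ : ∃ m, n = m + 2 := ⟨n - 2, by omega⟩
    rw [show 2 * (m + 2) - 4 = 2 * m by omega, show (2 * m) ^ 2 = 4 * m ^ 2 by ring,
      Nat.mul_div_cancel_left _ (by norm_num), show (m + 2) ^ 2 = m ^ 2 + 4 * m + 4 by ring]
    omega
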